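/- arXiv:math/0502403 — 2 statements merged into one kernel-verified Lean document; each statement's English description precedes it below -/
import Mathlib

section
/- Let C be a skeletally small abelian category which is finitary: every Hom-set of C is finite and, for each element of the Grothendieck group K₀(C), there are only finitely many isomorphism classes of objects of C whose class in K₀(C) equals that element. Then for all objects X, Y, Z, M of C, Σ_{[L]} F_{XY}^L · F_{LZ}^M = Σ_{[L']} F_{XL'}^M · F_{YZ}^{L'}, where both sums range over the isomorphism classes of objects of C and each sum has only finitely many nonzero terms. -/
open CategoryTheory CategoryTheory.Limits

universe v u

namespace HallExact

variable {C : Type u} [Category.{v} C] [Abelian C]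

/-- `(f, g)` forms a short exact sequence `0 → Y → L → X → 0`. -/
def IsSES {X Y L : C} (f : Y ⟶ L) (g : L ⟶ X) : Prop :=
  ∃ w : f ≫ g = 0, (ShortComplex.mk f g w).ShortExact

/-- `W X Y L` is the set of short exact sequences `0 → Y → L → X → 0`. -/
def W (X Y L : C) : Type v :=
  {p : (Y ⟶ L) × (L ⟶ X) // IsSES p.1 p.2}

/-- The orbit relation on `W X Y L` for the action of `Aut X × Aut Y`,
where `(ξ, η) • (f, g) = (f ∘ η⁻¹, ξ ∘ g)`. -/
def WRel (X Y L : C) (p q : W X Y L) : Prop :=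
  ∃ (ξ : Aut X) (η : Aut Y),
    q.1.1 = η.inv ≫ p.1.1 ∧ q.1.2 = p.1.2 ≫ ξ.hom

/-- The Hall number `F_{XY}^L`, the number of orbits of `Aut X × Aut Y` on `W X Y L`. -/
noncomputable def F (X Y L : C) : ℕ :=
  Nat.card (Quot (WRel X Y L))

variable (C)

/-- The subgroup of relations defining the Grothendieck group: `[X] + [Y] - [L]`
for every short exact sequence `0 → Y → L → X → 0`. -/
def K0Rels : AddSubgroup (FreeAbelianGroup (Quotient (isIsomorphicSetoid C))) :=
  AddSubgroup.closure
    {x | ∃ (X Y L : C) (f : Y ⟶ L) (g : L ⟶ X), IsSES f g ∧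
      x = FreeAbelianGroup.of (Quotient.mk (isIsomorphicSetoid C) X) +
          FreeAbelianGroup.of (Quotient.mk (isIsomorphicSetoid C) Y) -
          FreeAbelianGroup.of (Quotient.mk (isIsomorphicSetoid C) L)}

/-- The Grothendieck group `K₀(C)`: the free abelian group on the isomorphism classes
of objects of `C` modulo the relations `[X] + [Y] - [L]` coming from short exact
sequences `0 → Y → L → X → 0`. -/
def K0 : Type u :=
  FreeAbelianGroup (Quotient (isIsomorphicSetoid C)) ⧸ K0Rels C

noncomputable instance : AddCommGroup (K0 C) :=
  QuotientAddGroup.Quotient.addCommGroup (K0Rels C)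

variable {C}

/-- The class of an object of `C` in the Grothendieck group `K₀(C)`. -/
def k0Class (A : C) : K0 C :=
  QuotientAddGroup.mk (FreeAbelianGroup.of (Quotient.mk (isIsomorphicSetoid C) A))


lemma IsSES.mono {X Y L : C} {f : Y ⟶ L} {g : L ⟶ X} (h : IsSES f g) : Mono f :=
  h.choose_spec.mono_f

lemma IsSES.epi {X Y L : C} {f : Y ⟶ L} {g : L ⟶ X} (h : IsSES f g) : Epi g :=
  h.choose_spec.epi_g

lemma IsSES.zero {X Y L : C} {f : Y ⟶ L} {g : L ⟶ X} (h : IsSES f g) : f ≫ g = 0 :=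
  h.choose

lemma IsSES.exists_lift {X Y L A : C} {f : Y ⟶ L} {g : L ⟶ X} (h : IsSES f g) (k : A ⟶ L)
    (hk : k ≫ g = 0) : ∃ l : A ⟶ Y, l ≫ f = k :=
  ⟨h.choose_spec.fIsKernel.lift (KernelFork.ofι k hk),
    h.choose_spec.fIsKernel.fac _ WalkingParallelPair.zero⟩

lemma IsSES.exists_desc {X Y L A : C} {f : Y ⟶ L} {g : L ⟶ X} (h : IsSES f g) (k : L ⟶ A)
    (hk : f ≫ k = 0) : ∃ l : X ⟶ A, g ≫ l = k :=
  ⟨h.choose_spec.gIsCokernel.desc (CokernelCofork.ofπ k hk),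
    h.choose_spec.gIsCokernel.fac _ WalkingParallelPair.one⟩

lemma IsSES.of_kernel {X Y L : C} {f : Y ⟶ L} {g : L ⟶ X} (w : f ≫ g = 0)
    (hf : IsLimit (KernelFork.ofι f w)) (hg : Epi g) : IsSES f g :=
  ⟨w, ShortComplex.ShortExact.mk' (ShortComplex.exact_of_f_is_kernel _ hf)
    (mono_of_isLimit_fork hf) hg⟩

lemma IsSES.of_cokernel {X Y L : C} {f : Y ⟶ L} {g : L ⟶ X} (w : f ≫ g = 0)
    (hg : IsColimit (CokernelCofork.ofπ g w)) (hf : Mono f) : IsSES f g :=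
  ⟨w, ShortComplex.ShortExact.mk' (ShortComplex.exact_of_g_is_cokernel _ hg)
    hf (epi_of_isColimit_cofork hg)⟩

lemma IsSES.trans {X Y L X' Y' L' : C} {f : Y ⟶ L} {g : L ⟶ X} (h : IsSES f g)
    (η : Y ≅ Y') (l : L ≅ L') (ξ : X ≅ X') :
    IsSES (η.inv ≫ f ≫ l.hom) (l.inv ≫ g ≫ ξ.hom) := by
  obtain ⟨w, h⟩ := h
  refine ⟨by simp [reassoc_of% w], ?_⟩
  refine ShortComplex.shortExact_of_iso (ShortComplex.isoMk η l ξ ?_ ?_) h <;> simp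

lemma IsSES.left_iso {X Y L X' Y' : C} {f : Y ⟶ L} {g : L ⟶ X} {f' : Y' ⟶ L} {g' : L ⟶ X'}
    (h : IsSES f g) (h' : IsSES f' g') (ξ : X ≅ X') (e : g' = g ≫ ξ.hom) :
    ∃ θ : Y ≅ Y', f' = θ.inv ≫ f := by
  have := h.mono
  have := h'.mono
  obtain ⟨a, ha⟩ := h.exists_lift f' (by
    have := h'.zero
    rwa [e, ← Category.assoc, ← zero_comp (f := ξ.hom), cancel_mono] at this)
  obtain ⟨b, hb⟩ := h'.exists_lift f (by rw [e, ← Category.assoc, h.zero, zero_comp])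
  exact ⟨⟨b, a, by simp [← cancel_mono f, ha, hb], by simp [← cancel_mono f', ha, hb]⟩, ha.symm⟩

lemma IsSES.right_iso {X Y L X' Y' : C} {f : Y ⟶ L} {g : L ⟶ X} {f' : Y' ⟶ L} {g' : L ⟶ X'}
    (h : IsSES f g) (h' : IsSES f' g') (η : Y ≅ Y') (e : f' = η.inv ≫ f) :
    ∃ θ : X ≅ X', g' = g ≫ θ.hom := by
  have := h.epi
  have := h'.epi
  obtain ⟨a, ha⟩ := h.exists_desc g' (by
    have := h'.zero
    rw [e, Category.assoc] at this
    simpa using this)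
  obtain ⟨b, hb⟩ := h'.exists_desc g (by rw [e, Category.assoc, h.zero, comp_zero])
  exact ⟨⟨a, b, by simp [← cancel_epi g, reassoc_of% ha, hb],
    by simp [← cancel_epi g', reassoc_of% hb, ha]⟩, ha.symm⟩

lemma wRel_equivalence (X Y L : C) : Equivalence (WRel X Y L) where
  refl p := ⟨Iso.refl _, Iso.refl _, by simp, by simp⟩
  symm := by
    rintro p q ⟨(ξ : X ≅ X), (η : Y ≅ Y), h1, h2⟩
    exact ⟨ξ.symm, η.symm, by simp [h1], by simp [h2]⟩
  trans := by
    rintro p q r ⟨(ξ : X ≅ X), (η : Y ≅ Y), h1, h2⟩ ⟨(ξ' : X ≅ X), (η' : Y ≅ Y), h1', h2'⟩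
    exact ⟨Iso.trans ξ ξ', Iso.trans η η', by simp [h1, h1'], by simp [h2, h2']⟩

lemma wRel_out {X Y L : C} (p : W X Y L) : WRel X Y L p (Quot.mk (WRel X Y L) p).out :=
  ((wRel_equivalence X Y L).quot_mk_eq_iff _ _).1 (Quot.out_eq _).symm

lemma eq_of_out {X Y L : C} {a b : Quot (WRel X Y L)} (h : WRel X Y L a.out b.out) : a = b := by
  rw [← Quot.out_eq a, ← Quot.out_eq b]
  exact Quot.sound h

/-- Two-step filtrations, described through the submodule step. -/
def LeftFlag {X Z M : C} (Y : C) (z : Z ⟶ M) (q : M ⟶ X) : Prop :=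
  ∃ (K : C) (i : Z ⟶ K) (v : K ⟶ M) (p : K ⟶ Y), i ≫ v = z ∧ IsSES v q ∧ IsSES i p

/-- Two-step filtrations, described through the quotient step. -/
def RightFlag {X Z M : C} (Y : C) (z : Z ⟶ M) (q : M ⟶ X) : Prop :=
  ∃ (L : C) (g' : M ⟶ L) (g : L ⟶ X) (f : Y ⟶ L), g' ≫ g = q ∧ IsSES z g' ∧ IsSES f g

lemma LeftFlag.right {X Y Z M : C} {z : Z ⟶ M} {q : M ⟶ X} (h : LeftFlag Y z q) :
    RightFlag Y z q := by
  obtain ⟨K, i, v, p, e, hv, hi⟩ := h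
  have w : z ≫ q = 0 := by rw [← e, Category.assoc, hv.zero, comp_zero]
  have := hv.mono
  have := hi.mono
  have := hv.epi
  have hz : Mono z := by rw [← e]; infer_instance
  let S := ShortComplex.mk z q w
  have hk := hv.choose_spec.fIsKernel
  have el : hk.lift (KernelFork.ofι z w) = i := by
    rw [← cancel_mono v, e]
    exact hk.fac _ WalkingParallelPair.zero
  have wp : hk.lift (KernelFork.ofι z w) ≫ p = 0 := by rw [el, hi.zero]
  let lh : S.LeftHomologyData :=
    { K := K, H := Y, i := v, π := p, wi := hv.zero, hi := hk, wπ := wp,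
      hπ := CokernelCofork.IsColimit.ofπ _ _
        (fun k hk => (hi.exists_desc k (by rw [← el]; exact hk)).choose)
        (fun k hk => (hi.exists_desc k (by rw [← el]; exact hk)).choose_spec)
        (fun k hk m hm => by
          have := hi.epi
          rw [← cancel_epi p, hm]
          exact (hi.exists_desc k (by rw [← el]; exact hk)).choose_spec.symm) }
  let r := S.rightHomologyData
  let θ : r.H ≅ Y := r.homologyIso.symm ≪≫ lh.homologyIso
  have hg : r.p ≫ r.g' = q := r.p_g'
  have hge : Epi r.g' := epi_of_epi_fac hg
  refine ⟨r.Q, r.p, r.g', θ.inv ≫ r.ι, hg, IsSES.of_cokernel r.wp r.hp hz, ?_⟩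
  have h0 : IsSES r.ι r.g' := IsSES.of_kernel r.ι_g' r.hι hge
  simpa using h0.trans θ (Iso.refl _) (Iso.refl _)

lemma RightFlag.left {X Y Z M : C} {z : Z ⟶ M} {q : M ⟶ X} (h : RightFlag Y z q) :
    LeftFlag Y z q := by
  obtain ⟨L, g', g, f, e, hz, hf⟩ := h
  have w : z ≫ q = 0 := by rw [← e, ← Category.assoc, hz.zero, zero_comp]
  have := hz.epi
  have := hf.epi
  have := hz.mono
  have hq : Epi q := by rw [← e]; infer_instance
  let S := ShortComplex.mk z q w
  have hk := hz.choose_spec.gIsCokernel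
  have el : hk.desc (CokernelCofork.ofπ q w) = g := by
    rw [← cancel_epi g', e]
    exact hk.fac _ WalkingParallelPair.one
  have wp : f ≫ hk.desc (CokernelCofork.ofπ q w) = 0 := by rw [el, hf.zero]
  let rh : S.RightHomologyData :=
    { Q := L, H := Y, p := g', ι := f, wp := hz.zero, hp := hk, wι := wp,
      hι := KernelFork.IsLimit.ofι _ _
        (fun k hk => (hf.exists_lift k (by rw [← el]; exact hk)).choose)
        (fun k hk => (hf.exists_lift k (by rw [← el]; exact hk)).choose_spec)
        (fun k hk m hm => by
          have := hf.mono
          rw [← cancel_mono f, hm]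
          exact (hf.exists_lift k (by rw [← el]; exact hk)).choose_spec.symm) }
  let l := S.leftHomologyData
  let θ : l.H ≅ Y := l.homologyIso.symm ≪≫ rh.homologyIso
  have hg : l.f' ≫ l.i = z := l.f'_i
  have hge : Mono l.f' := mono_of_mono_fac hg
  refine ⟨l.K, l.f', l.i, l.π ≫ θ.hom, hg, IsSES.of_kernel l.wi l.hi hq, ?_⟩
  have h0 : IsSES l.f' l.π := IsSES.of_cokernel l.f'_π l.hπ hge
  simpa using h0.trans (Iso.refl _) (Iso.refl _) θ

/-- The set of flags, before dividing by automorphisms. -/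
def Flag (X Y Z M : C) : Type v :=
  {p : (Z ⟶ M) × (M ⟶ X) // LeftFlag Y p.1 p.2}

/-- The orbit relation on flags. -/
def FlagRel (X Y Z M : C) (p q : Flag X Y Z M) : Prop :=
  ∃ (ξ : Aut X) (η : Aut Z), q.1.1 = η.inv ≫ p.1.1 ∧ q.1.2 = p.1.2 ≫ ξ.hom

lemma flagRel_equivalence (X Y Z M : C) : Equivalence (FlagRel X Y Z M) where
  refl p := ⟨Iso.refl _, Iso.refl _, by simp, by simp⟩
  symm := by
    rintro p q ⟨(ξ : X ≅ X), (η : Z ≅ Z), h1, h2⟩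
    exact ⟨ξ.symm, η.symm, by simp [h1], by simp [h2]⟩
  trans := by
    rintro p q r ⟨(ξ : X ≅ X), (η : Z ≅ Z), h1, h2⟩ ⟨(ξ' : X ≅ X), (η' : Z ≅ Z), h1', h2'⟩
    exact ⟨Iso.trans ξ ξ', Iso.trans η η', by simp [h1, h1'], by simp [h2, h2']⟩

/-- The flag of a pair of short exact sequences, submodule version. -/
def mkLeft {X Y Z M K : C} (a : W X K M) (b : W Y Z K) : Flag X Y Z M :=
  ⟨(b.1.1 ≫ a.1.1, a.1.2), K, b.1.1, a.1.1, b.1.2, rfl, a.2, b.2⟩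

/-- The flag of a pair of short exact sequences, quotient version. -/
def mkRight {X Y Z M L : C} (a : W X Y L) (b : W L Z M) : Flag X Y Z M :=
  ⟨(b.1.1, b.1.2 ≫ a.1.2), RightFlag.left ⟨L, b.1.2, a.1.2, a.1.1, rfl, b.2, a.2⟩⟩

lemma left_bijective (R : Set C) (hR : ∀ A : C, ∃! B, B ∈ R ∧ Nonempty (A ≅ B)) (X Y Z M : C) :
    Function.Bijective (fun t : Σ K : R, Quot (WRel X (K : C) M) × Quot (WRel Y Z (K : C)) =>
      Quot.mk (FlagRel X Y Z M) (mkLeft t.2.1.out t.2.2.out)) := by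
  constructor
  · rintro ⟨K, a, b⟩ ⟨K', a', b'⟩ h
    obtain ⟨ξ, η, h1, h2⟩ := ((flagRel_equivalence X Y Z M).quot_mk_eq_iff _ _).1 h
    simp only [mkLeft] at h1 h2
    obtain ⟨θ, hθ⟩ := a.out.2.left_iso a'.out.2 ξ h2
    obtain rfl : K = K' := Subtype.ext ((hR K).unique ⟨K.2, ⟨Iso.refl _⟩⟩ ⟨K'.2, ⟨θ⟩⟩)
    obtain rfl : a = a' := eq_of_out ⟨ξ, θ, hθ, h2⟩
    have hm := a.out.2.mono
    rw [← Category.assoc, cancel_mono] at h1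
    obtain ⟨ξ', h3⟩ := b.out.2.right_iso b'.out.2 η h1
    obtain rfl : b = b' := eq_of_out ⟨ξ', η, h1, h3⟩
    rfl
  · intro t
    induction t using Quot.ind with | _ d
    obtain ⟨⟨z, q⟩, K, i, v, p, e, hv, hi⟩ := d
    obtain ⟨B, ⟨hB, ⟨θ⟩⟩, -⟩ := hR K
    have hv' : IsSES (θ.inv ≫ v) q := by
      simpa using hv.trans θ (Iso.refl _) (Iso.refl _)
    let a : W X B M := ⟨(θ.inv ≫ v, q), hv'⟩
    obtain ⟨ξ, (η : B ≅ B), h1, h2⟩ := wRel_out a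
    have hi' : IsSES (i ≫ θ.hom ≫ η.hom) (η.inv ≫ θ.inv ≫ p) := by
      simpa using hi.trans (Iso.refl _) (θ ≪≫ η) (Iso.refl _)
    let b : W Y Z B := ⟨(i ≫ θ.hom ≫ η.hom, η.inv ≫ θ.inv ≫ p), hi'⟩
    obtain ⟨ξ', η', h3, h4⟩ := wRel_out b
    refine ⟨⟨⟨B, hB⟩, Quot.mk _ a, Quot.mk _ b⟩, (Quot.sound ⟨ξ, η', ?_, h2⟩).symm⟩
    simp only [mkLeft]
    rw [h1, h3]
    have e' : i ≫ v = z := e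
    simp [a, b, e']

lemma right_bijective (R : Set C) (hR : ∀ A : C, ∃! B, B ∈ R ∧ Nonempty (A ≅ B)) (X Y Z M : C) :
    Function.Bijective (fun t : Σ L : R, Quot (WRel X Y (L : C)) × Quot (WRel (L : C) Z M) =>
      Quot.mk (FlagRel X Y Z M) (mkRight t.2.1.out t.2.2.out)) := by
  constructor
  · rintro ⟨K, b, a⟩ ⟨K', b', a'⟩ h
    obtain ⟨ξ, η, h1, h2⟩ := ((flagRel_equivalence X Y Z M).quot_mk_eq_iff _ _).1 h
    simp only [mkRight] at h1 h2
    obtain ⟨θ, hθ⟩ := a.out.2.right_iso a'.out.2 η h1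
    obtain rfl : K = K' := Subtype.ext ((hR K).unique ⟨K.2, ⟨Iso.refl _⟩⟩ ⟨K'.2, ⟨θ⟩⟩)
    obtain rfl : a = a' := eq_of_out ⟨θ, η, h1, hθ⟩
    have hm := a.out.2.epi
    rw [Category.assoc, cancel_epi] at h2
    obtain ⟨η', h3⟩ := b.out.2.left_iso b'.out.2 ξ h2
    obtain rfl : b = b' := eq_of_out ⟨ξ, η', h3, h2⟩
    rfl
  · intro t
    induction t using Quot.ind with | _ d
    obtain ⟨⟨z, q⟩, hd⟩ := d
    obtain ⟨L, g', g, f, e, hz, hf⟩ := hd.right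
    obtain ⟨B, ⟨hB, ⟨θ⟩⟩, -⟩ := hR L
    have hz' : IsSES z (g' ≫ θ.hom) := by
      simpa using hz.trans (Iso.refl _) (Iso.refl _) θ
    let a : W B Z M := ⟨(z, g' ≫ θ.hom), hz'⟩
    obtain ⟨(ξ : B ≅ B), η, h1, h2⟩ := wRel_out a
    have hf' : IsSES (f ≫ θ.hom ≫ ξ.hom) (ξ.inv ≫ θ.inv ≫ g) := by
      simpa using hf.trans (Iso.refl _) (θ ≪≫ ξ) (Iso.refl _)
    let b : W X Y B := ⟨(f ≫ θ.hom ≫ ξ.hom, ξ.inv ≫ θ.inv ≫ g), hf'⟩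
    obtain ⟨ξ', η', h3, h4⟩ := wRel_out b
    refine ⟨⟨⟨B, hB⟩, Quot.mk _ b, Quot.mk _ a⟩, (Quot.sound ⟨ξ', η, h1, ?_⟩).symm⟩
    simp only [mkRight]
    rw [h2, h4]
    have e' : g' ≫ g = q := e
    simp [a, b, reassoc_of% e']

lemma k0Class_eq {X Y L : C} (h : F X Y L ≠ 0) : k0Class L = k0Class X + k0Class Y := by
  have hne : Nonempty (Quot (WRel X Y L)) := by
    by_contra hc
    rw [not_nonempty_iff] at hc
    exact h Nat.card_of_isEmpty
  obtain ⟨t⟩ := hne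
  refine (sub_eq_zero.1 ?_).symm
  exact (QuotientAddGroup.eq_zero_iff _).2
    (AddSubgroup.subset_closure ⟨X, Y, L, t.out.1.1, t.out.1.2, t.out.2, rfl⟩)

lemma finsum_card {ι : Type*} (β : ι → Type*) [∀ i, Finite (β i)]
    (h : {i | Nat.card (β i) ≠ 0}.Finite) :
    ∑ᶠ i, Nat.card (β i) = Nat.card (Σ i, β i) := by
  rw [finsum_eq_sum_of_support_subset (s := h.toFinset) _ (by intro i; simp),
    ← Finset.sum_coe_sort, ← Nat.card_sigma]
  refine Nat.card_congr (Equiv.ofBijective (fun t => ⟨t.1.1, t.2⟩) ⟨?_, ?_⟩)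
  · rintro ⟨⟨i, hi⟩, x⟩ ⟨⟨j, hj⟩, y⟩ e
    simp only [Sigma.mk.injEq] at e
    obtain ⟨rfl, e⟩ := e
    simpa using e
  · rintro ⟨i, x⟩
    have : Nonempty (β i) := ⟨x⟩
    exact ⟨⟨⟨i, by simpa using Nat.card_pos.ne'⟩, x⟩, rfl⟩

/-- Associativity of Hall numbers: if `C` is finitary (finite Hom-sets and finitely many
isomorphism classes in each Grothendieck group class), then
`Σ_{[L]} F_{XY}^L F_{LZ}^M = Σ_{[L']} F_{XL'}^M F_{YZ}^{L'}`, where both sums range over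
a set `R` of representatives of the isomorphism classes and have finite support. -/
theorem hall_associative (R : Set C)
    (hR : ∀ A : C, ∃! B, B ∈ R ∧ Nonempty (A ≅ B))
    (hHom : ∀ A B : C, Finite (A ⟶ B))
    (hFin : ∀ g : K0 C, {A : R | k0Class (A : C) = g}.Finite)
    (X Y Z M : C) :
    {L : R | F X Y (L : C) * F (L : C) Z M ≠ 0}.Finite ∧
    {L' : R | F X (L' : C) M * F Y Z (L' : C) ≠ 0}.Finite ∧
    ∑ᶠ L : R, F X Y (L : C) * F (L : C) Z M =
      ∑ᶠ L' : R, F X (L' : C) M * F Y Z (L' : C) := by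
  have hfin : ∀ A B L : C, Finite (Quot (WRel A B L)) := fun A B L => by
    have := hHom B L
    have := hHom L A
    have : Finite (W A B L) := Subtype.finite
    infer_instance
  have h1 : {L : R | F X Y (L : C) * F (L : C) Z M ≠ 0}.Finite :=
    (hFin (k0Class X + k0Class Y)).subset fun L hL => k0Class_eq (left_ne_zero_of_mul hL)
  have h2 : {L' : R | F X (L' : C) M * F Y Z (L' : C) ≠ 0}.Finite :=
    (hFin (k0Class Y + k0Class Z)).subset fun L hL => k0Class_eq (right_ne_zero_of_mul hL)
  refine ⟨h1, h2, ?_⟩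
  simp only [F, ← Nat.card_prod] at h1 h2 ⊢
  rw [finsum_card _ h1, finsum_card _ h2, Nat.card_eq_of_bijective _ (right_bijective R hR X Y Z M),
    Nat.card_eq_of_bijective _ (left_bijective R hR X Y Z M)]

end HallExact
end

section
/- Let k be a finite field and let C be an idempotent-complete, k-linear triangulated category with shift functor T in which all Hom-spaces are finite. Let t : Y →f Z →g X →h TY be a distinguished triangle in which X, Y, and Z are all indecomposable (in particular t is not split). Then the endomorphism ring End(t) of t — the ring of triples (η, ζ, ξ) ∈ End(Y) × End(Z) × End(X) with ζ∘f = f∘η, ξ∘g = g∘ζ and (Tη)∘h = h∘ξ — is a local ring. -/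
open CategoryTheory CategoryTheory.Limits CategoryTheory.Pretriangulated

universe v u

namespace HallTri

variable {k : Type} [Field k] [Fintype k]
variable {C : Type u} [Category.{v} C] [HasZeroObject C] [HasShift C ℤ] [Preadditive C]
  [∀ n : ℤ, (shiftFunctor C n).Additive] [Pretriangulated C] [IsTriangulated C]
  [Linear k C] [IsIdempotentComplete C] [HasBinaryBiproducts C]

/-- The endomorphism ring of a triangle `t : Y →f Z →g X →h TY`: the subring of
`End Y × End Z × End X` of triples `(η, ζ, ξ)` with `ζ∘f = f∘η`, `ξ∘g = g∘ζ` and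
`(Tη)∘h = h∘ξ`. -/
def TriangleEnd {X Y Z : C} (f : Y ⟶ Z) (g : Z ⟶ X) (h : X ⟶ Y⟦(1 : ℤ)⟧) :
    Subring (End Y × End Z × End X) where
  carrier := {e | f ≫ e.2.1 = e.1 ≫ f ∧ g ≫ e.2.2 = e.2.1 ≫ g ∧
    h ≫ (shiftFunctor C (1 : ℤ)).map e.1 = e.2.2 ≫ h}
  one_mem' := by
    simp [End.one_def]
  mul_mem' := by
    rintro a b ⟨ha1, ha2, ha3⟩ ⟨hb1, hb2, hb3⟩
    refine ⟨?_, ?_, ?_⟩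
    · show f ≫ b.2.1 ≫ a.2.1 = (b.1 ≫ a.1) ≫ f
      rw [← Category.assoc, hb1, Category.assoc, ha1, ← Category.assoc]
    · show g ≫ b.2.2 ≫ a.2.2 = (b.2.1 ≫ a.2.1) ≫ g
      rw [← Category.assoc, hb2, Category.assoc, ha2, ← Category.assoc]
    · show h ≫ (shiftFunctor C (1 : ℤ)).map (b.1 ≫ a.1) = (b.2.2 ≫ a.2.2) ≫ h
      rw [Functor.map_comp, ← Category.assoc, hb3, Category.assoc, ha3,
        ← Category.assoc]
  zero_mem' := by
    simp
  add_mem' := by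
    rintro a b ⟨ha1, ha2, ha3⟩ ⟨hb1, hb2, hb3⟩
    refine ⟨?_, ?_, ?_⟩
    · show f ≫ (a.2.1 + b.2.1) = (a.1 + b.1) ≫ f
      rw [Preadditive.comp_add, Preadditive.add_comp, ha1, hb1]
    · show g ≫ (a.2.2 + b.2.2) = (a.2.1 + b.2.1) ≫ g
      rw [Preadditive.comp_add, Preadditive.add_comp, ha2, hb2]
    · show h ≫ (shiftFunctor C (1 : ℤ)).map (a.1 + b.1) = (a.2.2 + b.2.2) ≫ h
      rw [Functor.map_add, Preadditive.comp_add, Preadditive.add_comp, ha3, hb3]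
  neg_mem' := by
    rintro a ⟨ha1, ha2, ha3⟩
    refine ⟨?_, ?_, ?_⟩
    · show f ≫ (-a.2.1) = (-a.1) ≫ f
      rw [Preadditive.comp_neg, Preadditive.neg_comp, ha1]
    · show g ≫ (-a.2.2) = (-a.2.1) ≫ g
      rw [Preadditive.comp_neg, Preadditive.neg_comp, ha2]
    · show h ≫ (shiftFunctor C (1 : ℤ)).map (-a.1) = (-a.2.2) ≫ h
      rw [Functor.map_neg, Preadditive.comp_neg, Preadditive.neg_comp, ha3]

theorem isIdem_trivial {D : Type*} [Category D] [Preadditive D] [IsIdempotentComplete D]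
    [HasBinaryBiproducts D] {X : D} (hX : Indecomposable X) (p : X ⟶ X) (hp : p ≫ p = p) :
    p = 0 ∨ p = 𝟙 X := by
  obtain ⟨A, i, e, hie, hei⟩ := IsIdempotentComplete.idempotents_split X p hp
  have hq : (𝟙 X - p) ≫ (𝟙 X - p) = 𝟙 X - p := by
    simp [hp]
  obtain ⟨B, j, d, hjd, hdj⟩ := IsIdempotentComplete.idempotents_split X (𝟙 X - p) hq
  have hid : i ≫ d = 0 := by
    have h1 : i ≫ d = (i ≫ e) ≫ i ≫ d ≫ (j ≫ d) := by simp [hie, hjd]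
    rw [h1]
    have h2 : e ≫ i ≫ d ≫ j = 0 := by
      rw [← Category.assoc e, hei, hdj]; simp [hp]
    calc (i ≫ e) ≫ i ≫ d ≫ j ≫ d = i ≫ (e ≫ i ≫ d ≫ j) ≫ d := by simp only [Category.assoc]
      _ = 0 := by rw [h2]; simp
  have hje : j ≫ e = 0 := by
    have h1 : j ≫ e = (j ≫ d) ≫ j ≫ e ≫ (i ≫ e) := by simp [hie, hjd]
    rw [h1]
    have h2 : d ≫ j ≫ e ≫ i = 0 := by
      rw [← Category.assoc d, hei, hdj]; simp [hp]
    calc (j ≫ d) ≫ j ≫ e ≫ i ≫ e = j ≫ (d ≫ j ≫ e ≫ i) ≫ e := by simp only [Category.assoc]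
      _ = 0 := by rw [h2]; simp
  let φ : X ≅ A ⊞ B :=
    { hom := biprod.lift e d
      inv := biprod.desc i j
      hom_inv_id := by rw [biprod.lift_desc, hei, hdj]; simp
      inv_hom_id := by
        ext <;> simp [hie, hjd, hid, hje] }
  rcases hX.2 A B φ with h | h
  · left
    rw [← hei, h.eq_zero_of_src i, comp_zero]
  · right
    have : 𝟙 X - p = 0 := by rw [← hdj, h.eq_zero_of_src j, comp_zero]
    exact (sub_eq_zero.1 this).symm

theorem exists_pow_idem {M : Type*} [Monoid M] [Finite M] (a : M) :
    ∃ n : ℕ, n ≠ 0 ∧ a ^ n * a ^ n = a ^ n := by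
  obtain ⟨m, n, hmn, h⟩ := Finite.exists_ne_map_eq_of_infinite (fun n : ℕ => a ^ n)
  wlog hlt : m < n generalizing m n
  · exact this n m hmn.symm h.symm (by omega)
  obtain ⟨p, rfl⟩ := Nat.exists_eq_add_of_lt hlt
  change a ^ m = a ^ (m + p + 1) at h
  have key : ∀ c l : ℕ, a ^ (m + l + c * (p + 1)) = a ^ (m + l) := by
    intro c l
    induction c with
    | zero => simp
    | succ c ih =>
      have e : m + l + (c + 1) * (p + 1) = (m + p + 1) + (l + c * (p + 1)) := by ring
      rw [e, pow_add, ← h, ← pow_add, ← add_assoc, ih]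
  refine ⟨(m + 1) * (p + 1), by positivity, ?_⟩
  rw [← pow_add]
  have := key (m + 1) (m * p + p + 1)
  have e : m + (m * p + p + 1) = (m + 1) * (p + 1) := by ring
  rwa [e] at this

theorem isLocalRing_of_finite {R : Type*} [Ring R] [Finite R] [Nontrivial R]
    (H : ∀ e : R, e * e = e → e = 0 ∨ e = 1) : IsLocalRing R := by
  refine IsLocalRing.of_is_unit_or_is_unit_of_add_one ?_
  intro a b hab
  obtain ⟨n, hn, h⟩ := exists_pow_idem a
  rcases H _ h with h0 | h1
  · right
    have hb : b = 1 - a := by rw [← hab]; abel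
    rw [hb]
    exact IsNilpotent.isUnit_one_sub ⟨n, h0⟩
  · left
    exact IsUnit.of_pow_eq_one h1 hn

/-- Lemma 7: the endomorphism ring of a distinguished triangle `Y → Z → X → TY` with
`X`, `Y`, `Z` indecomposable is a local ring. -/
theorem triangleEnd_isLocalRing (hHom : ∀ A B : C, Finite (A ⟶ B))
    (X Y Z : C) (f : Y ⟶ Z) (g : Z ⟶ X) (h : X ⟶ Y⟦(1 : ℤ)⟧)
    (ht : Triangle.mk f g h ∈ distTriang C)
    (hX : Indecomposable X) (hY : Indecomposable Y) (hZ : Indecomposable Z) :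
    IsLocalRing (TriangleEnd f g h) := by
  have := hHom X X
  have := hHom Y Y
  have := hHom Z Z
  have : Finite (End X) := hHom X X
  have : Finite (End Y) := hHom Y Y
  have : Finite (End Z) := hHom Z Z
  have zX : ¬ (g = 0 ∧ h = 0) := fun hh =>
    hX.1 ((Triangle.isZero₃_iff _ ht).2 hh)
  have zY : ¬ (f = 0 ∧ h = 0) := fun hh =>
    hY.1 ((Triangle.isZero₁_iff _ ht).2 hh)
  have zZ : ¬ (f = 0 ∧ g = 0) := fun hh =>
    hZ.1 ((Triangle.isZero₂_iff _ ht).2 hh)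
  have : Nontrivial (TriangleEnd f g h) := by
    refine ⟨⟨0, 1, ?_⟩⟩
    intro h01
    have h1 : (0 : End X) = 1 := congrArg (fun e => e.1.2.2) h01
    exact hX.1 ((IsZero.iff_id_eq_zero X).2 h1.symm)
  apply isLocalRing_of_finite
  rintro ⟨⟨η, ζ, ξ⟩, h1, h2, h3⟩ he
  have e1 : η ≫ η = η := congrArg (fun e => e.1.1) he
  have e2 : ζ ≫ ζ = ζ := congrArg (fun e => e.1.2.1) he
  have e3 : ξ ≫ ξ = ξ := congrArg (fun e => e.1.2.2) he
  dsimp only at h1 h2 h3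
  rcases isIdem_trivial hY η e1 with rfl | rfl <;>
  rcases isIdem_trivial hZ ζ e2 with rfl | rfl <;>
  rcases isIdem_trivial hX ξ e3 with rfl | rfl
  · exact Or.inl rfl
  all_goals first | exact Or.inr rfl | skip
  all_goals
    exfalso
    simp only [CategoryTheory.Functor.map_zero, CategoryTheory.Functor.map_id, comp_zero, zero_comp, Category.comp_id,
      Category.id_comp] at h1 h2 h3
    first
      | exact zX ⟨by first | exact h2 | exact h2.symm, by first | exact h3 | exact h3.symm⟩
      | exact zY ⟨by first | exact h1 | exact h1.symm, by first | exact h3 | exact h3.symm⟩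
      | exact zZ ⟨by first | exact h1 | exact h1.symm, by first | exact h2 | exact h2.symm⟩

end HallTri
end
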